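/- Let n = 2m with m even, let S̃_n be Schur's double cover of S_n with projection π. In S_n let c₁ = (1, 2, …, m) and c₂ = (m+1, m+2, …, 2m) be the two disjoint m-cycles, and let β ∈ S_n be the involution sending i ↦ m+i and m+i ↦ i for 1 ≤ i ≤ m. Set G = π^{-1}(⟨c₁, c₂⟩) and G' = π^{-1}(⟨c₁, c₂, β⟩). Let (ρ, V) be a finite-dimensional irreducible complex representation of G with ρ(z) = −Id, and let w₁, w₂ ∈ G be any elements with π(w₁) = c₁ and π(w₂) = c₂. If tr ρ(w₁²) ≠ tr ρ(w₂²) and tr ρ(w₁²) ≠ −tr ρ(w₂²), then the induced module ℂ[G'] ⊗_{ℂ[G]} V is a simple ℂ[G']-module (i.e., the induced representation Ind_G^{G'} ρ is irreducible). -/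

import Mathlib

/-!
Schur's double cover `S̃_N` of the symmetric group, presented by generators
`z, t_1, …, t_{N-1}` and relations `z² = 1`, `t_i² = z`, `(t_i t_{i+1})³ = z`,
`(t_i t_j)² = z` for `|i − j| ≥ 2`.

Generators are indexed by `Option (Fin (N-1))`: `none` is the central element `z`
and `some i` is `t_{i+1}` (so `some i` for `i = 0, …, N-2` are `t_1, …, t_{N-1}`).
-/

abbrev SchurGen (N : ℕ) := Option (Fin (N - 1))

namespace Schur

/-- The relator `z` as an element of the free group. -/
def zf (N : ℕ) : FreeGroup (SchurGen N) := FreeGroup.of none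

/-- The generator `t_{i+1}` as an element of the free group. -/
def tf (N : ℕ) (i : Fin (N - 1)) : FreeGroup (SchurGen N) := FreeGroup.of (some i)

/-- The defining relators of Schur's double cover. -/
def rels (N : ℕ) : Set (FreeGroup (SchurGen N)) :=
  { r | r = zf N ^ 2 ∨
        (∃ i, r = tf N i ^ 2 * (zf N)⁻¹) ∨
        (∃ i j : Fin (N - 1), (i : ℕ) + 1 = (j : ℕ) ∧
          r = (tf N i * tf N j) ^ 3 * (zf N)⁻¹) ∨
        (∃ i j : Fin (N - 1), ((i : ℕ) + 2 ≤ (j : ℕ) ∨ (j : ℕ) + 2 ≤ (i : ℕ)) ∧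
          r = (tf N i * tf N j) ^ 2 * (zf N)⁻¹) }

/-- Schur's double cover `S̃_N` of the symmetric group `S_N`. -/
abbrev Cover (N : ℕ) := PresentedGroup (rels N)

/-- The central element `z` of `S̃_N`. -/
def z (N : ℕ) : Cover N := PresentedGroup.of none

/-- The generator `t_{i+1}` of `S̃_N` (0-indexed). -/
def t (N : ℕ) (i : Fin (N - 1)) : Cover N := PresentedGroup.of (some i)

/-- The generator `t_i` of `S̃_N`, 1-indexed: meaningful for `1 ≤ i ≤ N-1`
(junk value `1` outside this range). -/
def T (N i : ℕ) : Cover N := if h : i - 1 < N - 1 then t N ⟨i - 1, h⟩ else 1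

/-- The product `t_a t_{a+1} ⋯ t_{a+n-1}` (`n` consecutive generators, 1-indexed). -/
def P (N a n : ℕ) : Cover N := ((List.range n).map fun j => T N (a + j)).prod

end Schur


/-- The adjacent transposition `(i, i+1)` of `{1, …, n}`: in 0-indexed terms, for
`i : Fin (n-1)` this is the swap of `i` and `i+1` in `Fin n`.  It is the image of the
generator `t_{i+1}` under the canonical projection `S̃_n → S_n`. -/
def Schur.adj (n : ℕ) (i : Fin (n - 1)) : Equiv.Perm (Fin n) :=
  Equiv.swap ⟨i.1, by have := i.2; omega⟩ ⟨i.1 + 1, by have := i.2; omega⟩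

/-- The descending product `s (j + d - 1) * ⋯ * s (j + 1) * s j`. -/
def Schur.descProd {Q : Type*} [Group Q] (s : ℕ → Q) (j : ℕ) : ℕ → Q
  | 0 => 1
  | d + 1 => s (j + d) * descProd s j d

namespace Schur

section Coxeter

variable {Q : Type*} [Group Q] {s : ℕ → Q} {N : ℕ}

theorem descProd_mul_pred (j d : ℕ) :
    descProd s (j + 1) d * s j = descProd s j (d + 1) := by
  induction d with
  | zero => simp [descProd]
  | succ d ih =>
    rw [descProd, mul_assoc, ih, descProd, descProd, descProd, add_right_comm j 1 d, add_assoc]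

theorem commute_descProd (hcomm : ∀ i j, i + 1 < j → j < N → s i * s j = s j * s i)
    (i j d : ℕ) (hi : i < N) (hjd : j + d ≤ N) (h : i + 1 < j ∨ j + d < i) :
    descProd s j d * s i = s i * descProd s j d := by
  induction d with
  | zero => simp [descProd]
  | succ d ih =>
    have hc : s (j + d) * s i = s i * s (j + d) := by
      rcases h with h | h
      · exact (hcomm i (j + d) (by omega) (by omega)).symm
      · exact hcomm (j + d) i (by omega) hi
    rw [descProd, mul_assoc, ih (by omega) (by omega), ← mul_assoc, hc, mul_assoc]

theorem descProd_mul_shift (hcomm : ∀ i j, i + 1 < j → j < N → s i * s j = s j * s i)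
    (hbraid : ∀ i, i + 1 < N → s i * s (i + 1) * s i = s (i + 1) * s i * s (i + 1))
    (i j d : ℕ) (hjd : j + d ≤ N) (hj : j ≤ i) (hi : i + 1 < j + d) :
    descProd s j d * s (i + 1) = s i * descProd s j d := by
  induction d with
  | zero => omega
  | succ d ih =>
    rcases Nat.lt_or_ge (i + 1) (j + d) with h | h
    · rw [descProd, mul_assoc, ih (by omega) h, ← mul_assoc, ← hcomm i (j + d) h (by omega),
        mul_assoc]
    · obtain ⟨e, rfl⟩ : ∃ e, d = e + 1 := ⟨d - 1, by omega⟩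
      obtain rfl : i = j + e := by omega
      have hc := commute_descProd hcomm (j + e + 1) j e (by omega) (by omega) (by omega)
      calc s (j + e + 1) * (s (j + e) * descProd s j e) * s (j + e + 1)
          = s (j + e + 1) * s (j + e) * (descProd s j e * s (j + e + 1)) := by group
        _ = s (j + e + 1) * s (j + e) * s (j + e + 1) * descProd s j e := by rw [hc]; group
        _ = s (j + e) * (s (j + e + 1) * (s (j + e) * descProd s j e)) := by
          rw [← hbraid (j + e) (by omega)]; group

/-- Coset decomposition of the parabolic subgroup generated by the first `k + 1` generators. -/
theorem exists_eq_mul_descProd (hsq : ∀ i, i < N → s i * s i = 1)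
    (hcomm : ∀ i j, i + 1 < j → j < N → s i * s j = s j * s i)
    (hbraid : ∀ i, i + 1 < N → s i * s (i + 1) * s i = s (i + 1) * s i * s (i + 1))
    (k : ℕ) (hk : k < N) (g : Q) (hg : g ∈ Subgroup.closure (s '' Set.Iio (k + 1))) :
    ∃ h ∈ Subgroup.closure (s '' Set.Iio k), ∃ j d, j + d = k + 1 ∧ g = h * descProd s j d := by
  have key : ∀ g : Q, (∃ h ∈ Subgroup.closure (s '' Set.Iio k), ∃ j d, j + d = k + 1 ∧
      g = h * descProd s j d) → ∀ i, i < k + 1 →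
      ∃ h ∈ Subgroup.closure (s '' Set.Iio k), ∃ j d, j + d = k + 1 ∧
        g * s i = h * descProd s j d := by
    rintro _ ⟨h, hh, j, d, hjd, rfl⟩ i hi
    have hmem : ∀ l, l < k → h * s l ∈ Subgroup.closure (s '' Set.Iio k) := fun l hl =>
      mul_mem hh (Subgroup.subset_closure ⟨l, hl, rfl⟩)
    rcases lt_trichotomy i j with hij | rfl | hij
    · rcases Nat.lt_or_ge (i + 1) j with h1 | h1
      · refine ⟨h * s i, hmem i (by omega), j, d, hjd, ?_⟩
        rw [mul_assoc, mul_assoc,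
          commute_descProd hcomm i j d (by omega) (by omega) (Or.inl h1)]
      · obtain rfl : j = i + 1 := by omega
        exact ⟨h, hh, i, d + 1, by omega, by rw [mul_assoc, descProd_mul_pred]⟩
    · obtain ⟨e, rfl⟩ : ∃ e, d = e + 1 := ⟨d - 1, by omega⟩
      refine ⟨h, hh, i + 1, e, by omega, ?_⟩
      rw [← descProd_mul_pred, mul_assoc, mul_assoc, hsq i (by omega), mul_one]
    · obtain ⟨l, rfl⟩ : ∃ l, i = l + 1 := ⟨i - 1, by omega⟩
      refine ⟨h * s l, hmem l (by omega), j, d, hjd, ?_⟩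
      rw [mul_assoc, mul_assoc,
        descProd_mul_shift hcomm hbraid l j d (by omega) (by omega) (by omega)]
  induction hg using Subgroup.closure_induction_right with
  | one => exact ⟨1, one_mem _, k + 1, 0, rfl, by simp [descProd]⟩
  | mul_right x y hx hy ih =>
    obtain ⟨i, hi, rfl⟩ := hy
    exact key x ih i hi
  | mul_inv_cancel x y hx hy ih =>
    obtain ⟨i, hi, rfl⟩ := hy
    have hi' : i < k + 1 := hi
    rw [inv_eq_of_mul_eq_one_right (hsq i (by omega))]
    exact key x ih i hi

/-- A group generated by elements satisfying the Coxeter relations of type `A` maps injectively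
to the symmetric group. -/
theorem eq_one_of_map_eq_one {n : ℕ} (hsq : ∀ i, i < n - 1 → s i * s i = 1)
    (hcomm : ∀ i j, i + 1 < j → j < n - 1 → s i * s j = s j * s i)
    (hbraid : ∀ i, i + 1 < n - 1 → s i * s (i + 1) * s i = s (i + 1) * s i * s (i + 1))
    (φ : Q →* Equiv.Perm (Fin n)) (hφ : ∀ i : Fin (n - 1), φ (s i) = adj n i)
    (k : ℕ) (hk : k ≤ n - 1) (g : Q) (hg : g ∈ Subgroup.closure (s '' Set.Iio k))
    (h1 : φ g = 1) : g = 1 := by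
  have hfix : ∀ k, k ≤ n - 1 → ∀ g ∈ Subgroup.closure (s '' Set.Iio k),
      ∀ x : Fin n, k < x → φ g x = x := by
    intro k hk g hg x hx
    induction hg using Subgroup.closure_induction with
    | mem y hy =>
      obtain ⟨i, hi, rfl⟩ := hy
      have hi' : i < k := hi
      rw [hφ ⟨i, by omega⟩]
      refine Equiv.swap_apply_of_ne_of_ne ?_ ?_ <;>
      · intro h
        have := congrArg Fin.val h
        simp only at this
        omega
    | one => simp
    | mul a b _ _ ha hb => simp [ha, hb]
    | inv a _ ha =>
      rw [map_inv, Equiv.Perm.inv_eq_iff_eq, ha]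
  have hmove : ∀ j d (h : j + d < n),
      φ (descProd s j d) ⟨j, (Nat.le_add_right j d).trans_lt h⟩ = ⟨j + d, h⟩ := by
    intro j d
    induction d with
    | zero => intro h; simp [descProd]
    | succ d ih =>
      intro h
      rw [descProd, map_mul, Equiv.Perm.mul_apply, ih (by omega), hφ ⟨j + d, by omega⟩]
      exact Equiv.swap_apply_left _ _
  induction k generalizing g with
  | zero => simpa using hg
  | succ k ih =>
    obtain ⟨h, hh, j, d, hjd, rfl⟩ := exists_eq_mul_descProd hsq hcomm hbraid k hk g hg
    have e := congrArg (fun p : Equiv.Perm (Fin n) => p ⟨j, by omega⟩) h1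
    simp only [map_mul, Equiv.Perm.mul_apply, Equiv.Perm.one_apply] at e
    rw [hmove j d (by omega), hfix k (by omega) h hh _ (by simp only; omega)] at e
    have hd : j + d = j := congrArg Fin.val e
    obtain rfl : d = 0 := by omega
    simp only [descProd, mul_one] at h1 ⊢
    exact ih (by omega) h hh h1

end Coxeter

theorem z_sq (n : ℕ) : z n ^ 2 = 1 :=
  PresentedGroup.one_of_mem (rels := rels n) (x := zf n ^ 2) (Or.inl rfl)

theorem t_sq (n : ℕ) (i : Fin (n - 1)) : t n i ^ 2 = z n :=
  mul_inv_eq_one.mp <| PresentedGroup.one_of_mem (rels := rels n) (x := tf n i ^ 2 * (zf n)⁻¹)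
    (Or.inr (Or.inl ⟨i, rfl⟩))

theorem t_mul_t_cube (n : ℕ) (i j : Fin (n - 1)) (h : (i : ℕ) + 1 = j) :
    (t n i * t n j) ^ 3 = z n :=
  mul_inv_eq_one.mp <| PresentedGroup.one_of_mem (rels := rels n)
    (x := (tf n i * tf n j) ^ 3 * (zf n)⁻¹) (Or.inr (Or.inr (Or.inl ⟨i, j, h, rfl⟩)))

theorem t_mul_t_sq (n : ℕ) (i j : Fin (n - 1)) (h : (i : ℕ) + 2 ≤ j) :
    (t n i * t n j) ^ 2 = z n :=
  mul_inv_eq_one.mp <| PresentedGroup.one_of_mem (rels := rels n)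
    (x := (tf n i * tf n j) ^ 2 * (zf n)⁻¹)
    (Or.inr (Or.inr (Or.inr ⟨i, j, Or.inl h, rfl⟩)))

theorem z_commute (n : ℕ) (x : Cover n) : Commute (z n) x := by
  have hx : x ∈ Subgroup.centralizer {z n} := by
    have htop : Subgroup.closure (Set.range (PresentedGroup.of (rels := rels n))) ≤
        Subgroup.centralizer {z n} := by
      rw [Subgroup.closure_le]
      rintro _ ⟨_ | i, rfl⟩
      · exact Subgroup.mem_centralizer_singleton_iff.mpr rfl
      · refine Subgroup.mem_centralizer_singleton_iff.mpr ?_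
        rw [← t_sq n i]
        exact (Commute.refl (t n i)).pow_right 2
    rw [PresentedGroup.closure_range_of] at htop
    exact htop (Subgroup.mem_top x)
  exact (Subgroup.mem_centralizer_singleton_iff.mp hx).symm

instance zpowers_z_normal (n : ℕ) : (Subgroup.zpowers (z n)).Normal := by
  refine ⟨fun a ha g => ?_⟩
  obtain ⟨k, rfl⟩ := ha
  have h : Commute (z n ^ k) g := (z_commute n g).zpow_left k
  simp only [← h.eq, mul_inv_cancel_right]
  exact ⟨k, rfl⟩

/-- The kernel of the projection from Schur's double cover is contained in `⟨z⟩`. -/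
theorem mem_zpowers_z_of_map_eq_one (n : ℕ) (π : Cover n →* Equiv.Perm (Fin n))
    (hπt : ∀ i : Fin (n - 1), π (t n i) = adj n i) (hπz : π (z n) = 1)
    (x : Cover n) (hx : π x = 1) : x ∈ Subgroup.zpowers (z n) := by
  let q : Cover n →* Cover n ⧸ Subgroup.zpowers (z n) := QuotientGroup.mk' _
  have hqz : q (z n) = 1 :=
    (QuotientGroup.eq_one_iff _).mpr (Subgroup.mem_zpowers (z n))
  let s : ℕ → Cover n ⧸ Subgroup.zpowers (z n) :=
    fun i => if h : i < n - 1 then q (t n ⟨i, h⟩) else 1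
  have hs : ∀ i (h : i < n - 1), s i = q (t n ⟨i, h⟩) := fun i h => dif_pos h
  have hsq : ∀ i, i < n - 1 → s i * s i = 1 := by
    intro i hi
    rw [hs i hi, ← map_mul, ← pow_two, t_sq, hqz]
  have hinv : ∀ i, i < n - 1 → (s i)⁻¹ = s i := fun i hi =>
    inv_eq_of_mul_eq_one_right (hsq i hi)
  have hcomm : ∀ i j, i + 1 < j → j < n - 1 → s i * s j = s j * s i := by
    intro i j hij hj
    have hi : i < n - 1 := by omega
    have h : (s i * s j) ^ 2 = 1 := by
      rw [hs i hi, hs j hj, ← map_mul, ← map_pow,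
        t_mul_t_sq n ⟨i, hi⟩ ⟨j, hj⟩ (by simp only; omega), hqz]
    rw [pow_two] at h
    rw [eq_inv_of_mul_eq_one_left h, mul_inv_rev, hinv i hi, hinv j hj]
  have hbraid : ∀ i, i + 1 < n - 1 →
      s i * s (i + 1) * s i = s (i + 1) * s i * s (i + 1) := by
    intro i hj
    have hi : i < n - 1 := by omega
    have h : (s i * s (i + 1)) ^ 3 = 1 := by
      rw [hs i hi, hs (i + 1) hj, ← map_mul, ← map_pow,
        t_mul_t_cube n ⟨i, hi⟩ ⟨i + 1, hj⟩ rfl, hqz]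
    have h' : s i * s (i + 1) * s i * (s (i + 1) * s i * s (i + 1)) = 1 := by
      rw [← h]; simp only [pow_succ, pow_zero, one_mul, mul_assoc]
    rw [eq_inv_of_mul_eq_one_left h', mul_inv_rev, mul_inv_rev, hinv i hi, hinv (i + 1) hj,
      mul_assoc]
  have hker : ∀ y ∈ Subgroup.zpowers (z n), π y = 1 := by
    rintro _ ⟨k, rfl⟩
    simp [hπz]
  let φ : Cover n ⧸ Subgroup.zpowers (z n) →* Equiv.Perm (Fin n) :=
    QuotientGroup.lift _ π hker
  have hφq : ∀ y, φ (q y) = π y := fun y => QuotientGroup.lift_mk' _ hker y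
  have hφ : ∀ i : Fin (n - 1), φ (s i) = adj n i := fun i => by
    rw [hs i i.2, hφq, hπt]
  have hgen : q x ∈ Subgroup.closure (s '' Set.Iio (n - 1)) := by
    have htop : Subgroup.closure (Set.range (PresentedGroup.of (rels := rels n))) ≤
        (Subgroup.closure (s '' Set.Iio (n - 1))).comap q := by
      rw [Subgroup.closure_le]
      rintro _ ⟨_ | i, rfl⟩
      · change q (z n) ∈ Subgroup.closure (s '' Set.Iio (n - 1))
        rw [hqz]
        exact one_mem _
      · exact Subgroup.subset_closure ⟨i, i.2, hs i i.2⟩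
    rw [PresentedGroup.closure_range_of] at htop
    exact htop (Subgroup.mem_top x)
  have h1 := eq_one_of_map_eq_one hsq hcomm hbraid φ hφ (n - 1) le_rfl (q x) hgen
    ((hφq x).trans hx)
  exact (QuotientGroup.eq_one_iff x).mp h1

theorem projection_surjective (n : ℕ) (π : Cover n →* Equiv.Perm (Fin n))
    (hπt : ∀ i : Fin (n - 1), π (t n i) = adj n i) : Function.Surjective π := by
  rcases n with _ | n
  · exact fun p => ⟨1, Subsingleton.elim _ _⟩
  · have h := Equiv.Perm.mclosure_swap_castSucc_succ n
    intro p
    have hp : p ∈ Submonoid.closure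
        (Set.range fun i : Fin n => Equiv.swap i.castSucc i.succ) := h ▸ Submonoid.mem_top p
    have hle : Submonoid.closure (Set.range fun i : Fin n => Equiv.swap i.castSucc i.succ) ≤
        MonoidHom.mrange π := by
      rw [Submonoid.closure_le]
      rintro _ ⟨i, rfl⟩
      exact ⟨t (n + 1) i, hπt i⟩
    exact hle hp

end Schur

/-- Irreducibility of a representation induced from a subgroup `G` with `G' = G ∪ G b`, where
`b` normalizes `G`, when the character of the inducing representation is not `b`-invariant. -/
theorem induced_irreducible_of_trace_ne {Γ : Type*} [Group Γ] (G G' : Subgroup Γ) (hle : G ≤ G')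
    (b : G') (θ : G → G) (hθsurj : Function.Surjective θ)
    (hθ : ∀ g, b * Subgroup.inclusion hle g = Subgroup.inclusion hle (θ g) * b)
    (c : G) (hc : b * b = Subgroup.inclusion hle c)
    (hcov : ∀ x : G', ∃ g : G,
      x = Subgroup.inclusion hle g ∨ x = Subgroup.inclusion hle g * b)
    {k V : Type*} [Field k] [AddCommGroup V] [Module k V] [Nontrivial V]
    (ρ : G →* Module.End k V)
    (hirr : ∀ U : Submodule k V, (∀ h : G, U.map (ρ h) ≤ U) → U = ⊥ ∨ U = ⊤)
    (w : G) (htr : LinearMap.trace k V (ρ w) ≠ LinearMap.trace k V (ρ (θ w)))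
    (IndV : Submodule k (G' → V))
    (hIndV : ∀ f, f ∈ IndV ↔
      ∀ (g : G) (x : G'), f (Subgroup.inclusion hle g * x) = ρ g (f x))
    (σ : G' →* Module.End k (G' → V))
    (hσ : ∀ (x : G') (f : G' → V) (y : G'), σ x f y = f (y * x)) :
    IndV ≠ ⊥ ∧
      ∀ U, U ≤ IndV → (∀ x : G', Submodule.map (σ x) U ≤ U) → U = ⊥ ∨ U = IndV := by
  classical
  constructor
  · obtain ⟨v, hv⟩ := exists_ne (0 : V)
    intro hbot
    let f : G' → V := fun x => if h : (x : Γ) ∈ G then ρ ⟨x, h⟩ v else 0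
    have hf : f ∈ IndV := by
      rw [hIndV]
      intro g x
      by_cases hx : (x : Γ) ∈ G
      · have hgx : ((Subgroup.inclusion hle g * x : G') : Γ) ∈ G := mul_mem g.2 hx
        simp only [f, dif_pos hx, dif_pos hgx]
        rw [← Module.End.mul_apply, ← map_mul]
        rfl
      · have hgx : ((Subgroup.inclusion hle g * x : G') : Γ) ∉ G := fun h =>
          hx ((Subgroup.mul_mem_cancel_left G g.2).mp h)
        simp only [f, dif_neg hx, dif_neg hgx, map_zero]
    rw [hbot, Submodule.mem_bot] at hf
    have h1 : f 1 = 0 := congrFun hf 1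
    have h1G : ((1 : G') : Γ) ∈ G := one_mem G
    simp only [f, dif_pos h1G] at h1
    apply hv
    have e : (⟨((1 : G') : Γ), h1G⟩ : G) = 1 := rfl
    rwa [e, map_one, Module.End.one_apply] at h1
  intro U hU hinv
  have hσU : ∀ x, ∀ f ∈ U, σ x f ∈ U := fun x f hf => hinv x ⟨f, hf, rfl⟩
  have hext : ∀ f ∈ IndV, f 1 = 0 → f b = 0 → f = 0 := by
    intro f hf h1 hb
    rw [hIndV] at hf
    funext x
    obtain ⟨g, rfl | rfl⟩ := hcov x
    · rw [← mul_one (Subgroup.inclusion hle g), hf, h1, map_zero, Pi.zero_apply]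
    · rw [hf, hb, map_zero, Pi.zero_apply]
  have hG1 : ∀ f ∈ U, ∀ g, σ (Subgroup.inclusion hle g) f 1 = ρ g (f 1) := by
    intro f hf g
    rw [hσ, one_mul, ← mul_one (Subgroup.inclusion hle g), (hIndV f).mp (hU hf)]
  have hGb : ∀ f ∈ U, ∀ g, σ (Subgroup.inclusion hle g) f b = ρ (θ g) (f b) := by
    intro f hf g
    rw [hσ, hθ, (hIndV f).mp (hU hf)]
  have hb1 : ∀ f, σ b f 1 = f b := fun f => by rw [hσ, one_mul]
  have hbb : ∀ f ∈ U, σ b f b = ρ c (f 1) := by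
    intro f hf
    rw [hσ, hc, ← mul_one (Subgroup.inclusion hle c), (hIndV f).mp (hU hf)]
  let ev₁ : U →ₗ[k] V := (LinearMap.proj 1).comp U.subtype
  let evb : U →ₗ[k] V := (LinearMap.proj b).comp U.subtype
  have hK : ∀ h : G, ((LinearMap.ker evb).map ev₁).map (ρ h) ≤ (LinearMap.ker evb).map ev₁ := by
    rintro g _ ⟨_, ⟨f, hf, rfl⟩, rfl⟩
    have hfb : f.1 b = 0 := hf
    refine ⟨⟨σ (Subgroup.inclusion hle g) f, hσU _ _ f.2⟩, ?_, hG1 f f.2 g⟩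
    change σ (Subgroup.inclusion hle g) f b = 0
    rw [hGb f f.2, hfb, map_zero]
  rcases hirr _ hK with hK | hK
  · left
    have hinjb : ∀ f ∈ U, f b = 0 → f = 0 := by
      intro f hf hfb
      refine hext f (hU hf) ?_ hfb
      have : f 1 ∈ (LinearMap.ker evb).map ev₁ := ⟨⟨f, hf⟩, hfb, rfl⟩
      rwa [hK] at this
    have hinj1 : ∀ f ∈ U, f 1 = 0 → f = 0 := by
      intro f hf hf1
      have h0 : σ b f = 0 := hinjb _ (hσU b f hf) (by rw [hbb f hf, hf1, map_zero])
      refine hext f (hU hf) hf1 ?_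
      rw [← hb1 f, h0, Pi.zero_apply]
    by_contra hne
    obtain ⟨f₀, hf₀, hf₀0⟩ := U.ne_bot_iff.mp hne
    have hR1 : LinearMap.range ev₁ = ⊤ := by
      refine (hirr _ ?_).resolve_left ?_
      · rintro g _ ⟨_, ⟨f, rfl⟩, rfl⟩
        exact ⟨⟨σ (Subgroup.inclusion hle g) f, hσU _ _ f.2⟩, hG1 f f.2 g⟩
      · intro h
        refine hf₀0 (hinj1 f₀ hf₀ ?_)
        have : f₀ 1 ∈ LinearMap.range ev₁ := ⟨⟨f₀, hf₀⟩, rfl⟩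
        rwa [h] at this
    have hRb : LinearMap.range evb = ⊤ := by
      refine (hirr _ ?_).resolve_left ?_
      · rintro g _ ⟨_, ⟨f, rfl⟩, rfl⟩
        obtain ⟨g, rfl⟩ := hθsurj g
        exact ⟨⟨σ (Subgroup.inclusion hle g) f, hσU _ _ f.2⟩, hGb f f.2 g⟩
      · intro h
        refine hf₀0 (hinjb f₀ hf₀ ?_)
        have : f₀ b ∈ LinearMap.range evb := ⟨⟨f₀, hf₀⟩, rfl⟩
        rwa [h] at this
    let e₁ : U ≃ₗ[k] V := LinearEquiv.ofBijective ev₁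
      ⟨(injective_iff_map_eq_zero ev₁).mpr fun f hf => Subtype.ext (hinj1 f f.2 hf),
        LinearMap.range_eq_top.mp hR1⟩
    let eb : U ≃ₗ[k] V := LinearEquiv.ofBijective evb
      ⟨(injective_iff_map_eq_zero evb).mpr fun f hf => Subtype.ext (hinjb f f.2 hf),
        LinearMap.range_eq_top.mp hRb⟩
    let e : V ≃ₗ[k] V := e₁.symm.trans eb
    apply htr
    rw [← LinearMap.trace_conj' (ρ w) e]
    congr 1
    refine LinearMap.ext fun v => ?_
    obtain ⟨f, rfl⟩ := eb.surjective v
    have h2 : e.symm (eb f) = e₁ f := by simp [e]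
    have h3 : ρ w (e₁ f) = e₁ ⟨σ (Subgroup.inclusion hle w) f, hσU _ _ f.2⟩ :=
      (hG1 f f.2 w).symm
    rw [LinearEquiv.conj_apply_apply, h2, h3]
    simp only [e, LinearEquiv.trans_apply, LinearEquiv.symm_apply_apply]
    exact hGb f f.2 w
  · right
    refine le_antisymm hU fun F hF => ?_
    have hex : ∀ v, ∃ f ∈ U, f 1 = v ∧ f b = 0 := by
      intro v
      obtain ⟨f, hf, hfv⟩ : v ∈ (LinearMap.ker evb).map ev₁ := hK ▸ Submodule.mem_top
      exact ⟨f, f.2, hfv, hf⟩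
    obtain ⟨f₁, hf₁, h11, h1b⟩ := hex (F 1)
    obtain ⟨f₂, hf₂, h21, h2b⟩ := hex (ρ c⁻¹ (F b))
    have hmem : f₁ + σ b f₂ ∈ U := add_mem hf₁ (hσU b f₂ hf₂)
    have hsub : F - (f₁ + σ b f₂) = 0 := by
      refine hext _ (sub_mem hF (hU hmem)) ?_ ?_
      · rw [Pi.sub_apply, Pi.add_apply, hb1, h11, h2b, add_zero, sub_self]
      · rw [Pi.sub_apply, Pi.add_apply, hbb f₂ hf₂, h1b, h21, zero_add,
          ← Module.End.mul_apply, ← map_mul, mul_inv_cancel, map_one, Module.End.one_apply,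
          sub_self]
    rw [sub_eq_zero.mp hsub]
    exact hmem

open Schur in
/-- Lemma: let `n = 2m` with `m` even, let `c₁, c₂ ∈ S_n` be the two disjoint `m`-cycles
`(1, …, m)` and `(m+1, …, 2m)` and `β` the involution swapping the two blocks
(0-indexed below).  Put `G = π⁻¹(⟨c₁, c₂⟩)` and `G' = π⁻¹(⟨c₁, c₂, β⟩)` in `S̃_n`.
Let `(ρ, V)` be an irreducible spin representation of `G` and `w₁, w₂ ∈ G` preimages of
`c₁, c₂`.  If `tr ρ(w₁²) ≠ ± tr ρ(w₂²)`, then the induced representation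
`Ind_G^{G'} ρ` is irreducible.

We use the standard concrete model of the induced module for the index-2 subgroup `G`:
the space `IndV` of functions `f : G' → V` with `f (g·x) = ρ(g) (f x)` for `g ∈ G`
(isomorphic to `ℂ[G'] ⊗_{ℂ[G]} V`), with `G'` acting by right translation
`(x • f) y = f (y·x)`; simplicity of this `ℂ[G']`-module says it is nonzero and the only
`G'`-invariant subspaces contained in it are `⊥` and itself. -/
theorem schur_induced_spin_rep_irreducible (n m : ℕ) (hm : Even m) (hm0 : 0 < m)
    (hn : n = 2 * m)
    (π : Cover n →* Equiv.Perm (Fin n))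
    (hπt : ∀ i : Fin (n - 1), π (t n i) = adj n i)
    (hπz : π (z n) = 1)
    (c₁ c₂ β : Equiv.Perm (Fin n))
    (hc₁ : ∀ x : Fin n, ((c₁ x : Fin n) : ℕ) =
      if (x : ℕ) < m then ((x : ℕ) + 1) % m else (x : ℕ))
    (hc₂ : ∀ x : Fin n, ((c₂ x : Fin n) : ℕ) =
      if m ≤ (x : ℕ) then m + (((x : ℕ) - m + 1) % m) else (x : ℕ))
    (hβ : ∀ x : Fin n, ((β x : Fin n) : ℕ) =
      if (x : ℕ) < m then (x : ℕ) + m else (x : ℕ) - m)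
    (G G' : Subgroup (Cover n))
    (hG : G = (Subgroup.closure {c₁, c₂}).comap π)
    (hG' : G' = (Subgroup.closure {c₁, c₂, β}).comap π)
    (hle : G ≤ G')
    (V : Type) [AddCommGroup V] [Module ℂ V] [FiniteDimensional ℂ V] [Nontrivial V]
    (ρ : G →* Module.End ℂ V)
    (hirr : ∀ U : Submodule ℂ V, (∀ h : G, U.map (ρ h) ≤ U) → U = ⊥ ∨ U = ⊤)
    (hspin : ∀ x : G, (x : Cover n) = z n → ρ x = -1)
    (w₁ w₂ : G) (hw₁ : π (w₁ : Cover n) = c₁) (hw₂ : π (w₂ : Cover n) = c₂)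
    (htr : LinearMap.trace ℂ V (ρ (w₁ ^ 2)) ≠ LinearMap.trace ℂ V (ρ (w₂ ^ 2)) ∧
      LinearMap.trace ℂ V (ρ (w₁ ^ 2)) ≠ -LinearMap.trace ℂ V (ρ (w₂ ^ 2)))
    (IndV : Submodule ℂ (G' → V))
    (hIndV : ∀ f, f ∈ IndV ↔
      ∀ (g : G) (x : G'), f (Subgroup.inclusion hle g * x) = ρ g (f x))
    (σ : G' →* Module.End ℂ (G' → V))
    (hσ : ∀ (x : G') (f : G' → V) (y : G'), σ x f y = f (y * x)) :
    IndV ≠ ⊥ ∧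
      ∀ U, U ≤ IndV → (∀ x : G', Submodule.map (σ x) U ≤ U) → U = ⊥ ∨ U = IndV := by
  have hββ : β * β = 1 := by
    ext x
    have := x.2
    rw [Equiv.Perm.mul_apply, hβ, hβ, Equiv.Perm.one_apply]
    split_ifs <;> omega
  have hβc₁ : β * c₁ = c₂ * β := by
    ext x
    have := x.2
    have := Nat.mod_lt ((x : ℕ) + 1) hm0
    simp only [Equiv.Perm.mul_apply, hβ, hc₁, hc₂]
    by_cases hx : (x : ℕ) < m
    · rw [if_pos hx, if_pos hx, if_pos this, if_pos (by omega), Nat.add_sub_cancel, add_comm]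
    · rw [if_neg hx, if_neg hx, if_neg (by omega)]
  have hβinv : β⁻¹ = β := inv_eq_of_mul_eq_one_right hββ
  have hconj₁ : β * c₁ * β⁻¹ = c₂ := by rw [hβc₁, mul_inv_cancel_right]
  have hconj₂ : β * c₂ * β⁻¹ = c₁ := by
    rw [← hconj₁, hβinv]
    simp only [mul_assoc, hββ, mul_one]
    rw [← mul_assoc, hββ, one_mul]
  have hconjK : ∀ x ∈ Subgroup.closure {c₁, c₂}, β * x * β⁻¹ ∈ Subgroup.closure {c₁, c₂} := by
    have h : Subgroup.closure {c₁, c₂} ≤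
        (Subgroup.closure {c₁, c₂}).comap (MulAut.conj β).toMonoidHom := by
      rw [Subgroup.closure_le]
      rintro x (h | h)
      · change β * x * β⁻¹ ∈ Subgroup.closure {c₁, c₂}
        rw [h, hconj₁]
        exact Subgroup.subset_closure (Or.inr rfl)
      · change β * x * β⁻¹ ∈ Subgroup.closure {c₁, c₂}
        rw [Set.mem_singleton_iff.mp h, hconj₂]
        exact Subgroup.subset_closure (Or.inl rfl)
    exact fun x hx => h hx
  have hcovK : ∀ x ∈ Subgroup.closure {c₁, c₂, β},
      x ∈ Subgroup.closure {c₁, c₂} ∨ x * β⁻¹ ∈ Subgroup.closure {c₁, c₂} := by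
    intro x hx
    have hβr : ∀ y ∈ Subgroup.closure {c₁, c₂}, y * β * β⁻¹ ∈ Subgroup.closure {c₁, c₂} :=
      fun y hy => by rwa [mul_inv_cancel_right]
    induction hx using Subgroup.closure_induction with
    | mem x hx =>
      rcases hx with rfl | rfl | rfl
      · exact Or.inl (Subgroup.subset_closure (Or.inl rfl))
      · exact Or.inl (Subgroup.subset_closure (Or.inr rfl))
      · exact Or.inr (by rw [mul_inv_cancel]; exact one_mem _)
    | one => exact Or.inl (one_mem _)
    | mul x y _ _ hx hy =>
      rcases hx with hx | hx <;> rcases hy with hy | hy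
      · exact Or.inl (mul_mem hx hy)
      · exact Or.inr (by rw [mul_assoc]; exact mul_mem hx hy)
      · refine Or.inr ?_
        have e : x * y * β⁻¹ = x * β⁻¹ * (β * y * β⁻¹) := by group
        exact e ▸ mul_mem hx (hconjK y hy)
      · refine Or.inl ?_
        have e : x * y = x * β⁻¹ * (β * (y * β⁻¹) * β⁻¹) := by
          have : x * β⁻¹ * (β * (y * β⁻¹) * β⁻¹) = x * y * (β * β)⁻¹ := by group
          rw [this, hββ, inv_one, mul_one]
        exact e ▸ mul_mem hx (hconjK _ hy)
    | inv x _ hx =>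
      rcases hx with hx | hx
      · exact Or.inl (inv_mem hx)
      · refine Or.inr ?_
        have e : x⁻¹ * β⁻¹ = β * (x * β⁻¹)⁻¹ * β⁻¹ * (β * β)⁻¹ := by
          rw [hββ, inv_one, mul_one, mul_inv_rev, inv_inv, ← mul_assoc, hββ, one_mul]
        rw [e, hββ, inv_one, mul_one]
        exact hconjK _ (inv_mem hx)
  have hmemG : ∀ x, x ∈ G ↔ π x ∈ Subgroup.closure {c₁, c₂} := fun x => by
    rw [hG, Subgroup.mem_comap]
  have hmemG' : ∀ x, x ∈ G' ↔ π x ∈ Subgroup.closure {c₁, c₂, β} := fun x => by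
    rw [hG', Subgroup.mem_comap]
  obtain ⟨b, hb⟩ := projection_surjective n π hπt β
  have hbG' : b ∈ G' := by
    rw [hmemG', hb]
    exact Subgroup.subset_closure (Or.inr (Or.inr rfl))
  have hθG : ∀ g ∈ G, b * g * b⁻¹ ∈ G := fun g hg => by
    rw [hmemG] at hg ⊢
    simpa only [map_mul, map_inv, hb] using hconjK _ hg
  have hθG' : ∀ g ∈ G, b⁻¹ * g * b ∈ G := fun g hg => by
    rw [hmemG] at hg ⊢
    have := hconjK _ hg
    simpa only [map_mul, map_inv, hb, hβinv] using this
  have hbb : b * b ∈ G := by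
    rw [hmemG, map_mul, hb, hββ]
    exact one_mem _
  have hθw : b * (w₁ ^ 2 : G) * b⁻¹ = ((w₂ ^ 2 : G) : Cover n) := by
    have hk : π ((w₂ : Cover n)⁻¹ * (b * w₁ * b⁻¹)) = 1 := by
      rw [map_mul, map_mul, map_mul, map_inv, map_inv, hb, hw₁, hw₂, hconj₁, inv_mul_cancel]
    obtain ⟨k, hk⟩ := mem_zpowers_z_of_map_eq_one n π hπt hπz _ hk
    have e : b * w₁ * b⁻¹ = w₂ * z n ^ k := by
      rw [show z n ^ k = _ from hk, mul_inv_cancel_left]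
    have hz : (z n ^ k) ^ 2 = 1 := by
      rw [← zpow_natCast, zpow_comm, zpow_natCast, z_sq, one_zpow]
    have hcom : Commute (w₂ : Cover n) (z n ^ k) := (z_commute n _).symm.zpow_right k
    rw [Subgroup.coe_pow, Subgroup.coe_pow, ← conj_pow, e, hcom.mul_pow, hz, mul_one]
  refine induced_irreducible_of_trace_ne G G' hle ⟨b, hbG'⟩
    (fun g => ⟨b * g * b⁻¹, hθG g g.2⟩) ?_ ?_ ⟨b * b, hbb⟩ rfl ?_ ρ hirr (w₁ ^ 2) ?_
    IndV hIndV σ hσ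
  · intro g
    refine ⟨⟨b⁻¹ * g * b, hθG' g g.2⟩, Subtype.ext ?_⟩
    change b * (b⁻¹ * g * b) * b⁻¹ = g
    group
  · intro g
    refine Subtype.ext ?_
    change b * g = b * g * b⁻¹ * b
    group
  · intro x
    rcases hcovK _ ((hmemG' x).mp x.2) with hx | hx
    · exact ⟨⟨x, (hmemG x).mpr hx⟩, Or.inl rfl⟩
    · refine ⟨⟨x * b⁻¹, ?_⟩, Or.inr (Subtype.ext ?_)⟩
      · rw [hmemG, map_mul, map_inv, hb]
        exact hx
      · change (x : Cover n) = x * b⁻¹ * b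
        group
  · have e : (⟨b * (w₁ ^ 2 : G) * b⁻¹, hθG _ (w₁ ^ 2).2⟩ : G) = w₂ ^ 2 := Subtype.ext hθw
    rw [e]
    exact htr.1
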